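/- Let Q be a finite quiver, M a finite-dimensional representation of dimension vector d, and e a dimension vector with e ≤ d componentwise. If the quiver Grassmannian Gr_e(M) (the set of subrepresentations of M with dimension vector e) is nonempty, then its dimension as a projective variety is at least ⟨e, d−e⟩, the Euler form of Q evaluated at (e, d−e). -/

import Mathlib

/-!
STATEMENT 3: Let Q be a finite quiver, M a representation of dimension vector d over ℂ,
and e ≤ d componentwise. If the quiver Grassmannian `Gr_e(M)` is nonempty, then its
dimension is at least `⟨e, d−e⟩`, the Euler form of Q at `(e, d−e)`.

The quiver Grassmannian carries its Zariski topology (as a geometric quotient of a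
locally closed subset of affine space) and "dimension" is the topological Krull
dimension.  The inequality `dim ≥ ⟨e,d−e⟩ = Σᵢ eᵢ(d−e)ᵢ − Σ_α e_{s α}(d−e)_{t α}`
is stated additively in `WithBot ℕ∞` to avoid signed subtraction.
-/

noncomputable section
open Matrix

variable {V A : Type}

/-- A complex representation of the quiver `(V, A, s, t)` of dimension vector `d`. -/
abbrev QRep (s t : A → V) (d : V → ℕ) : Type :=
  ∀ a : A, Matrix (Fin (d (t a))) (Fin (d (s a))) ℂ

/-- The quiver Grassmannian `Gr_e(M)`: families of subspaces `N i ⊆ ℂ^{d i}` of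
dimension `e i` with `M_a (N (s a)) ⊆ N (t a)` for every arrow. -/
def SubRep (s t : A → V) {d : V → ℕ} (M : QRep s t d) (e : V → ℕ) : Type :=
  {N : ∀ i : V, Submodule ℂ (Fin (d i) → ℂ) //
    (∀ i, Module.finrank ℂ (N i) = e i) ∧
    ∀ a : A, (N (s a)).map (M a).mulVecLin ≤ N (t a)}

/-- The Zariski topology on the affine space `σ → ℂ`, induced from the Zariski
topology on the prime spectrum of the polynomial ring via `x ↦ ker (eval x)`. -/
def zariski (σ : Type) : TopologicalSpace (σ → ℂ) :=
  TopologicalSpace.induced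
    (fun x => (⟨RingHom.ker (MvPolynomial.eval x), RingHom.ker_isPrime _⟩ :
      PrimeSpectrum (MvPolynomial σ ℂ)))
    inferInstance

/-- Coordinates for a tuple of `(d i) × (e i)` matrices. -/
abbrev Coord (d e : V → ℕ) : Type := (Σ i : V, Fin (d i) × Fin (e i)) → ℂ

/-- The `i`-th matrix encoded by a coordinate vector. -/
def matOf {d e : V → ℕ} (F : Coord (V := V) d e) (i : V) :
    Matrix (Fin (d i)) (Fin (e i)) ℂ :=
  fun p q => F ⟨i, (p, q)⟩

/-- The affine "Stiefel-type" variety of tuples of injective linear maps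
`ℂ^{e i} → ℂ^{d i}` whose images form a subrepresentation of `M`. -/
def StQ (s t : A → V) {d : V → ℕ} (M : QRep s t d) (e : V → ℕ) : Type :=
  {F : Coord (V := V) d e //
    (∀ i, Function.Injective (matOf F i).mulVecLin) ∧
    ∀ a : A, (LinearMap.range (matOf F (s a)).mulVecLin).map (M a).mulVecLin ≤
      LinearMap.range (matOf F (t a)).mulVecLin}

/-- The canonical surjection from the Stiefel-type variety onto the quiver
Grassmannian, sending a tuple of injective maps to the tuple of their images. -/
def toSub (s t : A → V) {d : V → ℕ} (M : QRep s t d) (e : V → ℕ) :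
    StQ s t M e → SubRep s t M e := fun F =>
  ⟨fun i => LinearMap.range (matOf F.1 i).mulVecLin,
   fun i => by
     rw [LinearMap.finrank_range_of_inj (F.2.1 i)]
     exact Module.finrank_fin_fun ℂ,
   F.2.2⟩

/-- The Zariski topology on the quiver Grassmannian: the quotient (geometric
quotient) topology from the locally closed subset `StQ` of affine space. -/
instance (s t : A → V) {d : V → ℕ} (M : QRep s t d) (e : V → ℕ) :
    TopologicalSpace (SubRep s t M e) :=
  TopologicalSpace.coinduced (toSub s t M e)
    (TopologicalSpace.induced Subtype.val (zariski _))

section AffineVarieties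

open MvPolynomial Order TopologicalSpace

variable {σ : Type}

/-- The Zariski closed sets are the sets of common zeros of polynomials. -/
lemma isClosed_zariski_iff {C : Set (σ → ℂ)} :
    @IsClosed _ (zariski σ) C ↔
      ∃ S : Set (MvPolynomial σ ℂ), C = {x | ∀ f ∈ S, eval x f = 0} := by
  rw [zariski, isClosed_induced_iff]
  constructor
  · rintro ⟨T, hT, rfl⟩
    obtain ⟨S, rfl⟩ := (PrimeSpectrum.isClosed_iff_zeroLocus T).1 hT
    exact ⟨S, rfl⟩
  · rintro ⟨S, rfl⟩
    exact ⟨PrimeSpectrum.zeroLocus S, PrimeSpectrum.isClosed_zeroLocus S, rfl⟩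

/-- The affine variety of common zeros of a set of polynomials. -/
def AffineZeros (S : Set (MvPolynomial σ ℂ)) : Type :=
  {x : σ → ℂ // ∀ f ∈ S, eval x f = 0}

instance (S : Set (MvPolynomial σ ℂ)) : TopologicalSpace (AffineZeros S) :=
  .induced Subtype.val (zariski σ)

lemma AffineZeros.isClosed_iff {S : Set (MvPolynomial σ ℂ)} {C : Set (AffineZeros S)} :
    IsClosed C ↔ ∃ T : Set (MvPolynomial σ ℂ), C = {x | ∀ f ∈ T, eval x.1 f = 0} := by
  let := zariski σ
  rw [isClosed_induced_iff]
  constructor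
  · rintro ⟨T, hT, rfl⟩
    obtain ⟨S, rfl⟩ := isClosed_zariski_iff.1 hT
    exact ⟨S, rfl⟩
  · rintro ⟨T, rfl⟩
    exact ⟨_, isClosed_zariski_iff.2 ⟨T, rfl⟩, rfl⟩

/-- The Nullstellensatz for prime ideals. -/
lemma mem_of_forall_eval_eq_zero [Finite σ] {P : Ideal (MvPolynomial σ ℂ)} [P.IsPrime]
    {f : MvPolynomial σ ℂ}
    (h : ∀ x : σ → ℂ, (∀ g ∈ P, eval x g = 0) → eval x f = 0) : f ∈ P := by
  rw [← IsPrime.vanishingIdeal_zeroLocus (K := ℂ) P, mem_vanishingIdeal_iff]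
  intro x hx
  rw [aeval_eq_eval]
  refine h x fun g hg => ?_
  simpa [aeval_eq_eval] using hx g hg

/-- The irreducible closed subset of an affine variety defined by a prime ideal. -/
def AffineZeros.irreducibleCloseds [Finite σ] {S : Set (MvPolynomial σ ℂ)}
    (P : PrimeSpectrum (MvPolynomial σ ℂ)) (hP : S ⊆ P.asIdeal) :
    IrreducibleCloseds (AffineZeros S) where
  carrier := {x | ∀ f ∈ P.asIdeal, eval x.1 f = 0}
  isClosed' := AffineZeros.isClosed_iff.2 ⟨_, rfl⟩
  isIrreducible' := by
    constructor
    · by_contra hne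
      refine P.2.ne_top ((Ideal.eq_top_iff_one _).2 (mem_of_forall_eval_eq_zero fun x hx => ?_))
      exact (hne ⟨⟨x, fun f hf => hx f (hP hf)⟩, hx⟩).elim
    · rw [isPreirreducible_iff_isClosed_union_isClosed]
      intro C₁ C₂ h₁ h₂ hC
      obtain ⟨T₁, rfl⟩ := AffineZeros.isClosed_iff.1 h₁
      obtain ⟨T₂, rfl⟩ := AffineZeros.isClosed_iff.1 h₂
      by_contra! hcon
      simp only [Set.not_subset, Set.mem_ofPred_eq, not_forall] at hcon
      obtain ⟨⟨x, hx, f, hf, hfx⟩, ⟨y, hy, g, hg, hgy⟩⟩ := hcon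
      have hfg : f * g ∈ P.asIdeal := mem_of_forall_eval_eq_zero fun z hz => by
        rw [map_mul]
        rcases hC (show (⟨z, fun f hf => hz f (hP hf)⟩ : AffineZeros S) ∈ _ from hz) with h | h
        · rw [h f hf, zero_mul]
        · rw [h g hg, mul_zero]
      rcases P.2.mem_or_mem hfg with h | h
      · exact hfx (hx f h)
      · exact hgy (hy g h)

lemma AffineZeros.irreducibleCloseds_le_iff [Finite σ] {S : Set (MvPolynomial σ ℂ)}
    {P Q : PrimeSpectrum (MvPolynomial σ ℂ)} (hP : S ⊆ P.asIdeal) (hQ : S ⊆ Q.asIdeal) :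
    AffineZeros.irreducibleCloseds P hP ≤ AffineZeros.irreducibleCloseds Q hQ ↔ Q ≤ P := by
  constructor
  · intro h f hf
    refine mem_of_forall_eval_eq_zero fun x hx => ?_
    exact h (show (⟨x, fun f hf => hx f (hP hf)⟩ : AffineZeros S) ∈ _ from hx) f hf
  · intro h x hx f hf
    exact hx f (h hf)

lemma ringKrullDim_quotient_le_topologicalKrullDim [Finite σ] (S : Set (MvPolynomial σ ℂ)) :
    ringKrullDim (MvPolynomial σ ℂ ⧸ Ideal.span S) ≤ topologicalKrullDim (AffineZeros S) := by
  rw [ringKrullDim_quotient, topologicalKrullDim, ← krullDim_orderDual]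
  have hS (P : PrimeSpectrum.zeroLocus (Ideal.span S : Set (MvPolynomial σ ℂ))) :
      S ⊆ P.1.asIdeal := Ideal.subset_span.trans P.2
  refine krullDim_le_of_strictMono (fun P =>
    AffineZeros.irreducibleCloseds (OrderDual.ofDual P).1 (hS (OrderDual.ofDual P))) fun P Q hPQ => ?_
  rw [lt_iff_le_not_ge, AffineZeros.irreducibleCloseds_le_iff,
    AffineZeros.irreducibleCloseds_le_iff]
  exact lt_iff_le_not_ge.1 hPQ

/-- The ideal of a point of affine space has height at least the dimension of the space. -/
lemma card_le_height_ker_eval_zero {n : ℕ} (e : σ ≃ Fin n) :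
    (n : ℕ∞) ≤ (RingHom.ker (eval (0 : σ → ℂ))).height := by
  let φ (k : ℕ) : MvPolynomial σ ℂ →ₐ[ℂ] MvPolynomial σ ℂ :=
    aeval fun i => if (e i : ℕ) < k then 0 else X i
  have hφ {k l : ℕ} (hkl : k ≤ l) : (φ l).comp (φ k) = φ l := by
    refine MvPolynomial.algHom_ext fun i => ?_
    simp only [φ, AlgHom.comp_apply, aeval_X]
    split_ifs with h₁ h₂ h₂
    · simp
    · omega
    · simp [h₂]
    · simp [h₂]
  let P (k : Fin (n + 1)) : PrimeSpectrum (MvPolynomial σ ℂ) :=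
    ⟨RingHom.ker (φ k), RingHom.ker_isPrime _⟩
  have hP : StrictMono P := by
    refine Fin.strictMono_iff_lt_succ.2 fun k => lt_of_le_not_ge ?_ fun hle => ?_
    · intro f hf
      change φ _ f = 0 at hf
      change φ _ f = 0
      rw [← hφ (k := (k.castSucc : ℕ)) (by simp), AlgHom.comp_apply, hf, map_zero]
    · have h₁ : X (e.symm k) ∈ (P k.succ).asIdeal := by
        change φ _ _ = 0
        simp [φ]
      have h₂ : φ _ _ = 0 := hle h₁
      simp [φ] at h₂
  have hlen := Order.length_le_height_last (p := (⟨n, P, fun i => hP i.castSucc_lt_succ⟩ :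
    LTSeries (PrimeSpectrum (MvPolynomial σ ℂ))))
  let m : PrimeSpectrum (MvPolynomial σ ℂ) :=
    ⟨RingHom.ker (eval (0 : σ → ℂ)), RingHom.ker_isPrime _⟩
  have hm : P (Fin.last n) ≤ m := by
    intro f hf
    change φ _ f = 0 at hf
    change eval 0 f = 0
    have : (aeval (0 : σ → ℂ)).comp (φ (Fin.last n)) = aeval (0 : σ → ℂ) :=
      MvPolynomial.algHom_ext fun i => by simp [φ]
    rw [← aeval_eq_eval]
    change aeval (0 : σ → ℂ) f = 0
    rw [← this, AlgHom.comp_apply, hf, map_zero]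
  rw [show RingHom.ker (eval (0 : σ → ℂ)) = m.asIdeal from rfl,
    PrimeSpectrum.height_eq_orderHeight]
  exact hlen.trans (Order.height_mono hm)

/-- An affine variety through the origin, given by finitely many equations, has dimension at
least the number of variables minus the number of equations. -/
lemma card_le_topologicalKrullDim_add [Finite σ] (S : Set (MvPolynomial σ ℂ))
    (h0 : ∀ f ∈ S, eval 0 f = 0) :
    ((Nat.card σ : ℕ∞) : WithBot ℕ∞) ≤ topologicalKrullDim (AffineZeros S) + S.encard := by
  have : (RingHom.ker (eval (0 : σ → ℂ))).IsPrime := RingHom.ker_isPrime _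
  calc ((Nat.card σ : ℕ∞) : WithBot ℕ∞)
      ≤ ((RingHom.ker (eval (0 : σ → ℂ))).height : WithBot ℕ∞) :=
        WithBot.coe_le_coe.2 (card_le_height_ker_eval_zero (Finite.equivFin σ))
    _ ≤ ringKrullDim (MvPolynomial σ ℂ ⧸ Ideal.span S) + S.encard :=
        Ideal.height_le_ringKrullDim_quotient_add_encard S h0
    _ ≤ _ := by
        gcongr
        exact ringKrullDim_quotient_le_topologicalKrullDim S

end AffineVarieties

section Splittings

lemma Matrix.range_mulVecLin_le_iff {m k l : Type*} [Fintype k] [Fintype l] [DecidableEq k]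
    {F : Matrix m k ℂ} {G : Matrix m l ℂ} :
    LinearMap.range F.mulVecLin ≤ LinearMap.range G.mulVecLin ↔
      ∃ g : Matrix l k ℂ, F = G * g := by
  constructor
  · intro h
    have hcol (j : k) : ∃ w, G *ᵥ w = F.col j := by
      obtain ⟨w, hw⟩ := h ⟨Pi.single j 1, rfl⟩
      exact ⟨w, by simpa using hw⟩
    choose w hw using hcol
    refine ⟨Matrix.of fun p j => w j p, ?_⟩
    ext p j
    exact (congrFun (hw j) p).symm
  · rintro ⟨g, rfl⟩
    rw [Matrix.mulVecLin_mul]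
    exact LinearMap.range_comp_le_range _ _

lemma Matrix.map_range_mulVecLin {m n k : Type*} [Fintype n] [Fintype k]
    (A : Matrix m n ℂ) (F : Matrix n k ℂ) :
    (LinearMap.range F.mulVecLin).map A.mulVecLin = LinearMap.range (A * F).mulVecLin := by
  rw [Matrix.mulVecLin_mul, LinearMap.range_comp]

variable {m k l : Type} [Fintype m] [Fintype k] [Fintype l]
  [DecidableEq m] [DecidableEq k] [DecidableEq l]

/-- A decomposition of `ℂ^m` as a direct sum of `ℂ^k` and `ℂ^l`, given by the matrices of the
two inclusions and of the two projections. -/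
structure Splitting (m k l : Type) [Fintype m] [Fintype k] [Fintype l]
    [DecidableEq m] [DecidableEq k] [DecidableEq l] where
  inl : Matrix m k ℂ
  inr : Matrix m l ℂ
  fst : Matrix k m ℂ
  snd : Matrix l m ℂ
  fst_inl : fst * inl = 1
  fst_inr : fst * inr = 0
  snd_inl : snd * inl = 0
  snd_inr : snd * inr = 1
  sum_eq : inl * fst + inr * snd = 1

namespace Splitting

variable (c : Splitting m k l)

/-- The matrix whose image is the graph of `X : ℂ^k → ℂ^l`. -/
def frame (X : Matrix l k ℂ) : Matrix m k ℂ := c.inl + c.inr * X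

lemma fst_frame (X : Matrix l k ℂ) : c.fst * c.frame X = 1 := by
  rw [frame, Matrix.mul_add, ← Matrix.mul_assoc, c.fst_inl, c.fst_inr, Matrix.zero_mul, add_zero]

lemma snd_frame (X : Matrix l k ℂ) : c.snd * c.frame X = X := by
  rw [frame, Matrix.mul_add, ← Matrix.mul_assoc, c.snd_inl, c.snd_inr, Matrix.one_mul, zero_add]

lemma injective_frame (X : Matrix l k ℂ) : Function.Injective (c.frame X).mulVecLin := by
  refine Function.LeftInverse.injective (g := c.fst.mulVecLin) fun v => ?_
  simp [Matrix.mulVec_mulVec, c.fst_frame]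

lemma eq_add {n : Type} (F : Matrix m n ℂ) :
    F = c.inl * (c.fst * F) + c.inr * (c.snd * F) := by
  rw [← Matrix.mul_assoc, ← Matrix.mul_assoc, ← Matrix.add_mul, c.sum_eq, Matrix.one_mul]

lemma range_le_range_frame_iff {n : Type} [Fintype n] [DecidableEq n] {F : Matrix m n ℂ}
    {X : Matrix l k ℂ} :
    LinearMap.range F.mulVecLin ≤ LinearMap.range (c.frame X).mulVecLin ↔
      c.snd * F = X * (c.fst * F) := by
  rw [Matrix.range_mulVecLin_le_iff]
  constructor
  · rintro ⟨g, rfl⟩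
    rw [← Matrix.mul_assoc c.snd, ← Matrix.mul_assoc c.fst, c.fst_frame, c.snd_frame,
      Matrix.one_mul]
  · intro h
    refine ⟨c.fst * F, ?_⟩
    conv_lhs => rw [c.eq_add F, h]
    rw [frame, Matrix.add_mul, Matrix.mul_assoc c.inr]

/-- The linear map whose graph is the image of `F`, if that image is a graph. -/
def coord (F : Matrix m k ℂ) : Matrix l k ℂ := c.snd * F * (c.fst * F)⁻¹

lemma range_frame_coord {F : Matrix m k ℂ} (hF : (c.fst * F).det ≠ 0) :
    LinearMap.range (c.frame (c.coord F)).mulVecLin = LinearMap.range F.mulVecLin := by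
  have hu : IsUnit (c.fst * F).det := hF.isUnit
  have h : c.frame (c.coord F) = F * (c.fst * F)⁻¹ := by
    rw [c.eq_add (F * (c.fst * F)⁻¹), ← Matrix.mul_assoc c.fst, Matrix.mul_nonsing_inv _ hu,
      ← Matrix.mul_assoc c.snd, frame, coord, Matrix.mul_one]
  refine le_antisymm (Matrix.range_mulVecLin_le_iff.2 ⟨_, h⟩)
    (Matrix.range_mulVecLin_le_iff.2 ⟨c.fst * F, ?_⟩)
  rw [h, Matrix.mul_assoc, Matrix.nonsing_inv_mul _ hu, Matrix.mul_one]

lemma det_ne_zero_and_coord_eq {F : Matrix m k ℂ} {X : Matrix l k ℂ}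
    (h : LinearMap.range (c.frame X).mulVecLin = LinearMap.range F.mulVecLin) :
    (c.fst * F).det ≠ 0 ∧ c.coord F = X := by
  obtain ⟨g, hg⟩ := Matrix.range_mulVecLin_le_iff.1 h.le
  have hu : (c.fst * F) * g = 1 := by rw [Matrix.mul_assoc, ← hg, c.fst_frame]
  have hdet : IsUnit (c.fst * F).det := Matrix.isUnit_det_of_right_inverse hu
  refine ⟨hdet.ne_zero, ?_⟩
  rw [coord, c.range_le_range_frame_iff.1 h.ge, Matrix.mul_assoc, Matrix.mul_nonsing_inv _ hdet,
    Matrix.mul_one]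

end Splitting

/-- Every subspace is a summand of a splitting. -/
lemma exists_splitting {m k : ℕ} (N : Submodule ℂ (Fin m → ℂ)) (hN : Module.finrank ℂ N = k) :
    ∃ c : Splitting (Fin m) (Fin k) (Fin (m - k)),
      LinearMap.range c.inl.mulVecLin = N := by
  obtain ⟨W, hW⟩ := N.exists_isCompl
  have hWk : Module.finrank ℂ W = m - k := by
    have := Submodule.finrank_add_eq_of_isCompl hW
    rw [Module.finrank_fin_fun] at this
    omega
  let f : (Fin k → ℂ) ≃ₗ[ℂ] N := LinearEquiv.ofFinrankEq _ _ (by simp [hN])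
  let g : (Fin (m - k) → ℂ) ≃ₗ[ℂ] W := LinearEquiv.ofFinrankEq _ _ (by simp [hWk])
  let E := (f.prodCongr g).trans (Submodule.prodEquivOfIsCompl N W hW)
  let i₁ := E.toLinearMap ∘ₗ LinearMap.inl ℂ _ _
  let i₂ := E.toLinearMap ∘ₗ LinearMap.inr ℂ _ _
  let p₁ := LinearMap.fst ℂ _ _ ∘ₗ E.symm.toLinearMap
  let p₂ := LinearMap.snd ℂ _ _ ∘ₗ E.symm.toLinearMap
  refine ⟨⟨i₁.toMatrix', i₂.toMatrix', p₁.toMatrix', p₂.toMatrix', ?_, ?_, ?_, ?_, ?_⟩, ?_⟩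
  · rw [← LinearMap.toMatrix'_comp, ← LinearMap.toMatrix'_id]
    congr 1
    exact LinearMap.ext fun v => by simp [p₁, i₁]
  · rw [← LinearMap.toMatrix'_comp, ← map_zero LinearMap.toMatrix']
    congr 1
    exact LinearMap.ext fun v => by simp [p₁, i₂]
  · rw [← LinearMap.toMatrix'_comp, ← map_zero LinearMap.toMatrix']
    congr 1
    exact LinearMap.ext fun v => by simp [p₂, i₁]
  · rw [← LinearMap.toMatrix'_comp, ← LinearMap.toMatrix'_id]
    congr 1
    exact LinearMap.ext fun v => by simp [p₂, i₂]
  · rw [← LinearMap.toMatrix'_comp, ← LinearMap.toMatrix'_comp, ← LinearMap.toMatrix'_id,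
      ← map_add]
    congr 1
    refine LinearMap.ext fun v => ?_
    change E ((E.symm v).1, 0) + E (0, (E.symm v).2) = v
    rw [← map_add]
    simp
  · change LinearMap.range (Matrix.toLin' i₁.toMatrix') = N
    rw [Matrix.toLin'_toMatrix']
    have : i₁ = N.subtype ∘ₗ f.toLinearMap := LinearMap.ext fun v => by simp [i₁, E]
    rw [this, LinearMap.range_comp, LinearEquiv.range, Submodule.map_subtype_top]

end Splittings

section RegularFunctions

open MvPolynomial

variable {σ : Type}

/-- The functions on affine space that are quotients of a polynomial by a power of `h` wherever
`h` does not vanish. -/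
def regularFunctions (h : MvPolynomial σ ℂ) : Subalgebra ℂ ((σ → ℂ) → ℂ) where
  carrier := {u | ∃ (N : ℕ) (G : MvPolynomial σ ℂ),
    ∀ x, eval x h ≠ 0 → eval x G = eval x h ^ N * u x}
  mul_mem' := by
    rintro u v ⟨N, G, hG⟩ ⟨N', G', hG'⟩
    refine ⟨N + N', G * G', fun x hx => ?_⟩
    rw [map_mul, hG x hx, hG' x hx, Pi.mul_apply]
    ring
  add_mem' := by
    rintro u v ⟨N, G, hG⟩ ⟨N', G', hG'⟩
    refine ⟨N + N', h ^ N' * G + h ^ N * G', fun x hx => ?_⟩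
    rw [map_add, map_mul, map_mul, hG x hx, hG' x hx, Pi.add_apply, map_pow, map_pow]
    ring
  algebraMap_mem' r := ⟨0, C r, fun x _ => by simp⟩

lemma eval_mem_regularFunctions (h G : MvPolynomial σ ℂ) :
    (fun x => eval x G) ∈ regularFunctions h :=
  ⟨0, G, fun x _ => by simp⟩

lemma inv_eval_mem_regularFunctions {h g : MvPolynomial σ ℂ} (hg : g ∣ h) :
    (fun x => (eval x g)⁻¹) ∈ regularFunctions h := by
  obtain ⟨G, rfl⟩ := hg
  refine ⟨1, G, fun x hx => ?_⟩
  rw [map_mul] at hx ⊢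
  field_simp [left_ne_zero_of_mul hx]

lemma eval_comp_mem_regularFunctions {τ : Type} {h : MvPolynomial σ ℂ} {u : (σ → ℂ) → τ → ℂ}
    (hu : ∀ j, (fun x => u x j) ∈ regularFunctions h) (f : MvPolynomial τ ℂ) :
    (fun x => eval (u x) f) ∈ regularFunctions h := by
  induction f using MvPolynomial.induction_on with
  | C a =>
    simp only [eval_C]
    exact (regularFunctions h).algebraMap_mem a
  | add p q hp hq =>
    simp only [map_add]
    exact (regularFunctions h).add_mem hp hq
  | mul_X p j hp =>
    simp only [map_mul, eval_X]
    exact (regularFunctions h).mul_mem hp (hu j)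

end RegularFunctions

section Charts

open MvPolynomial Topology

variable {d e : V → ℕ}

variable (d e) in
/-- The `i`-th generic matrix. -/
def genericMat (i : V) : Matrix (Fin (d i)) (Fin (e i))
    (MvPolynomial (Σ i : V, Fin (d i) × Fin (e i)) ℂ) :=
  Matrix.of fun p q => X ⟨i, (p, q)⟩

lemma map_eval_genericMat (F : Coord d e) (i : V) :
    (genericMat d e i).map (eval F) = matOf F i := by
  ext p q
  simp [genericMat, matOf]

/-- The product of a constant matrix and a matrix of polynomials. -/
def constMul {σ l m n : Type} [Fintype m] (B : Matrix l m ℂ)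
    (G : Matrix m n (MvPolynomial σ ℂ)) : Matrix l n (MvPolynomial σ ℂ) :=
  B.map (C (σ := σ)) * G

lemma map_eval_constMul {σ l m n : Type} [Fintype m] (B : Matrix l m ℂ)
    (G : Matrix m n (MvPolynomial σ ℂ)) (x : σ → ℂ) :
    (constMul B G).map (eval x) = B * G.map (eval x) := by
  rw [constMul, Matrix.map_mul]
  congr 1
  ext p q
  simp

variable {s t : A → V} {M : QRep s t d}
  (c : ∀ i, Splitting (Fin (d i)) (Fin (e i)) (Fin (d i - e i)))

/-- The tuple of frames attached to a point of the affine chart. -/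
def chartFrame (x : Coord (fun i => d i - e i) e) : Coord d e :=
  fun j => (c j.1).frame (matOf x j.1) j.2.1 j.2.2

/-- The coordinates in the affine chart of a tuple of matrices. -/
def chartCoord (F : Coord d e) : Coord (fun i => d i - e i) e :=
  fun j => (c j.1).coord (matOf F j.1) j.2.1 j.2.2

lemma matOf_chartFrame (x : Coord (fun i => d i - e i) e) (i : V) :
    matOf (chartFrame c x) i = (c i).frame (matOf x i) := rfl

lemma matOf_chartCoord (F : Coord d e) (i : V) :
    matOf (chartCoord c F) i = (c i).coord (matOf F i) := rfl

/-- The matrix of polynomials whose values are the matrices `(c i).frame (matOf x i)`. -/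
def genericFrame (i : V) : Matrix (Fin (d i)) (Fin (e i))
    (MvPolynomial (Σ i : V, Fin (d i - e i) × Fin (e i)) ℂ) :=
  (c i).inl.map (C (σ := Σ i : V, Fin (d i - e i) × Fin (e i))) +
    constMul (c i).inr (genericMat (fun i => d i - e i) e i)

lemma map_eval_genericFrame (x : Coord (fun i => d i - e i) e) (i : V) :
    (genericFrame c i).map (eval x) = (c i).frame (matOf x i) := by
  rw [genericFrame, Matrix.map_add _ (map_add _), map_eval_constMul, map_eval_genericMat,
    Splitting.frame]
  congr 1
  ext p q
  simp

variable (M) in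
/-- The equations in the affine chart expressing compatibility with the arrow `a`. -/
def chartEquation (a : A) : Matrix (Fin (d (t a) - e (t a))) (Fin (e (s a)))
    (MvPolynomial (Σ i : V, Fin (d i - e i) × Fin (e i)) ℂ) :=
  constMul (c (t a)).snd (constMul (M a) (genericFrame c (s a))) -
    genericMat (fun i => d i - e i) e (t a) *
      constMul (c (t a)).fst (constMul (M a) (genericFrame c (s a)))

lemma map_eval_chartEquation (x : Coord (fun i => d i - e i) e) (a : A) :
    (chartEquation M c a).map (eval x) =
      (c (t a)).snd * (M a * (c (s a)).frame (matOf x (s a))) -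
        matOf x (t a) * ((c (t a)).fst * (M a * (c (s a)).frame (matOf x (s a)))) := by
  rw [chartEquation, Matrix.map_sub _ (map_sub _)]
  simp only [Matrix.map_mul, map_eval_constMul, map_eval_genericMat, map_eval_genericFrame]

variable (M) in
/-- All the equations of the quiver Grassmannian in the affine chart. -/
def chartEquations : Set (MvPolynomial (Σ i : V, Fin (d i - e i) × Fin (e i)) ℂ) :=
  Set.range fun j : Σ a : A, Fin (d (t a) - e (t a)) × Fin (e (s a)) =>
    chartEquation M c j.1 j.2.1 j.2.2

lemma forall_mem_chartEquations_iff {x : Coord (fun i => d i - e i) e} :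
    (∀ f ∈ chartEquations M c, eval x f = 0) ↔
      ∀ a, (LinearMap.range ((c (s a)).frame (matOf x (s a))).mulVecLin).map (M a).mulVecLin ≤
        LinearMap.range ((c (t a)).frame (matOf x (t a))).mulVecLin := by
  have h (a : A) : (LinearMap.range ((c (s a)).frame (matOf x (s a))).mulVecLin).map
      (M a).mulVecLin ≤ LinearMap.range ((c (t a)).frame (matOf x (t a))).mulVecLin ↔
      (chartEquation M c a).map (eval x) = 0 := by
    rw [Matrix.map_range_mulVecLin, Splitting.range_le_range_frame_iff, map_eval_chartEquation,
      sub_eq_zero]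
  simp only [h, chartEquations, Set.forall_mem_range, ← Matrix.ext_iff]
  exact ⟨fun H a p q => H ⟨a, p, q⟩, fun H j => H j.1 j.2.1 j.2.2⟩

/-- The parametrization of a chart of the Stiefel variety. -/
def chartLift (x : AffineZeros (chartEquations M c)) : StQ s t M e :=
  ⟨chartFrame c x.1, by
    simp only [matOf_chartFrame]
    exact ⟨fun i => (c i).injective_frame _, (forall_mem_chartEquations_iff c).1 x.2⟩⟩

lemma eval_det_genericMat (F : Coord d e) (i : V) :
    eval F (constMul (c i).fst (genericMat d e i)).det = ((c i).fst * matOf F i).det := by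
  rw [RingHom.map_det, RingHom.mapMatrix_apply, map_eval_constMul, map_eval_genericMat]

lemma isClosed_subRep_iff {D : Set (SubRep s t M e)} :
    IsClosed D ↔ ∃ T : Set (MvPolynomial (Σ i : V, Fin (d i) × Fin (e i)) ℂ),
      toSub s t M e ⁻¹' D = {F | ∀ f ∈ T, eval F.1 f = 0} := by
  rw [isClosed_coinduced, @isClosed_induced_iff _ _ (zariski _)]
  constructor
  · rintro ⟨C, hC, h⟩
    obtain ⟨T, rfl⟩ := isClosed_zariski_iff.1 hC
    exact ⟨T, h.symm⟩
  · rintro ⟨T, hT⟩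
    exact ⟨_, isClosed_zariski_iff.2 ⟨T, rfl⟩, hT.symm⟩

variable [Fintype V]

/-- The polynomial cutting out the complement of the chart. -/
def chartDet : MvPolynomial (Σ i : V, Fin (d i) × Fin (e i)) ℂ :=
  ∏ i, (constMul (c i).fst (genericMat d e i)).det

lemma eval_chartDet_ne_zero_iff (F : Coord d e) :
    eval F (chartDet c) ≠ 0 ↔ ∀ i, ((c i).fst * matOf F i).det ≠ 0 := by
  simp [chartDet, map_prod, Finset.prod_ne_zero_iff, eval_det_genericMat]

lemma chartCoord_mem_regularFunctions (j : Σ i : V, Fin (d i - e i) × Fin (e i)) :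
    (fun F : Coord d e => chartCoord c F j) ∈ regularFunctions (chartDet c) := by
  obtain ⟨i, p, q⟩ := j
  let G := constMul (c i).snd (genericMat d e i) * (constMul (c i).fst (genericMat d e i)).adjugate
  have hG (F : Coord d e) : eval F (G p q) =
      ((c i).snd * matOf F i * ((c i).fst * matOf F i).adjugate) p q := by
    rw [← Matrix.map_apply (f := eval F), Matrix.map_mul, map_eval_constMul,
      ← RingHom.mapMatrix_apply (eval F) (Matrix.adjugate _), RingHom.map_adjugate,
      RingHom.mapMatrix_apply, map_eval_constMul, map_eval_genericMat]
  have hdvd : (constMul (c i).fst (genericMat d e i)).det ∣ chartDet c :=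
    Finset.dvd_prod_of_mem _ (Finset.mem_univ i)
  convert! (regularFunctions (chartDet c)).mul_mem (inv_eval_mem_regularFunctions hdvd)
    (eval_mem_regularFunctions _ (G p q)) using 1
  ext F
  rw [Pi.mul_apply, hG, eval_det_genericMat]
  simp only [chartCoord, Splitting.coord]
  rw [Matrix.inv_def, Matrix.mul_smul, Matrix.smul_apply, Ring.inverse_eq_inv', smul_eq_mul]

lemma toSub_chartLift_eq {x : AffineZeros (chartEquations M c)} {F : StQ s t M e}
    (h : toSub s t M e (chartLift c x) = toSub s t M e F) :
    eval F.1 (chartDet c) ≠ 0 ∧ chartCoord c F.1 = x.1 := by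
  have hr (i : V) := congrFun (congrArg Subtype.val h) i
  simp only [toSub, chartLift, matOf_chartFrame] at hr
  have h' (i : V) := (c i).det_ne_zero_and_coord_eq (hr i)
  refine ⟨(eval_chartDet_ne_zero_iff c F.1).2 fun i => (h' i).1, ?_⟩
  ext ⟨i, p, q⟩
  exact congrFun (congrFun (h' i).2 p) q

lemma exists_toSub_chartLift_eq {F : StQ s t M e} (hF : eval F.1 (chartDet c) ≠ 0) :
    ∃ x : AffineZeros (chartEquations M c), x.1 = chartCoord c F.1 ∧
      toSub s t M e (chartLift c x) = toSub s t M e F := by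
  have h (i : V) := (c i).range_frame_coord ((eval_chartDet_ne_zero_iff c F.1).1 hF i)
  refine ⟨⟨chartCoord c F.1, (forall_mem_chartEquations_iff c).2 fun a => ?_⟩, rfl, ?_⟩
  · rw [matOf_chartCoord, matOf_chartCoord, h, h]
    exact F.2.2 a
  · exact Subtype.ext (funext h)

lemma isInducing_toSub_chartLift :
    IsInducing fun x : AffineZeros (chartEquations M c) => toSub s t M e (chartLift c x) := by
  refine ⟨TopologicalSpace.ext_iff_isClosed.2 fun K => ?_⟩
  refine AffineZeros.isClosed_iff.trans (Iff.trans ?_ isClosed_induced_iff.symm)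
  constructor
  · rintro ⟨T, rfl⟩
    choose N G hG using fun f => eval_comp_mem_regularFunctions
      (chartCoord_mem_regularFunctions c) f
    beta_reduce at hG
    refine ⟨{N | ∀ x : AffineZeros (chartEquations M c), toSub s t M e (chartLift c x) = N →
      ∀ f ∈ T, eval x.1 f = 0}, isClosed_subRep_iff.2 ⟨(fun f => chartDet c * G f) '' T, ?_⟩, ?_⟩
    · ext F
      simp only [Set.mem_preimage, Set.mem_ofPred_eq, Set.forall_mem_image, map_mul, mul_eq_zero]
      constructor
      · intro h f hf
        by_cases hF : eval F.1 (chartDet c) = 0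
        · exact .inl hF
        · obtain ⟨x, hx, hxF⟩ := exists_toSub_chartLift_eq c hF
          exact .inr (by rw [hG f _ hF, ← hx, h x hxF f hf, mul_zero])
      · intro h x hx f hf
        obtain ⟨hF, hFx⟩ := toSub_chartLift_eq c hx
        have := (h hf).resolve_left hF
        rw [hG f _ hF, hFx] at this
        exact (mul_eq_zero.1 this).resolve_left (pow_ne_zero _ hF)
    · ext x
      refine ⟨fun h => h x rfl, fun h y hy => ?_⟩
      have : y = x := Subtype.ext
        ((toSub_chartLift_eq c hy).2.symm.trans (toSub_chartLift_eq c rfl).2)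
      exact this ▸ h
  · rintro ⟨D, hD, rfl⟩
    obtain ⟨T, hT⟩ := isClosed_subRep_iff.1 hD
    refine ⟨(bind₁ fun j => genericFrame c j.1 j.2.1 j.2.2) '' T, ?_⟩
    ext x
    have hx : chartLift c x ∈ toSub s t M e ⁻¹' D ↔
        ∀ f ∈ T, eval (chartFrame c x.1) f = 0 := by
      rw [hT]
      exact Iff.rfl
    refine hx.trans ?_
    have hframe : (fun j => eval x.1 (genericFrame c j.1 j.2.1 j.2.2)) = chartFrame c x.1 :=
      funext fun j => congrFun (congrFun (map_eval_genericFrame c x.1 j.1) j.2.1) j.2.2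
    simp only [Set.mem_ofPred_eq, Set.forall_mem_image]
    refine forall₂_congr fun f hf => ?_
    rw [← aeval_eq_eval x.1]
    rw [aeval_bind₁]
    simp only [aeval_eq_eval]
    rw [← hframe]

end Charts

/-- A nonempty quiver Grassmannian has dimension at least
`⟨e, d − e⟩`. -/
theorem subRep_dim_ge (s t : A → V) [Fintype V] [Fintype A]
    (d e : V → ℕ) (hle : ∀ i, e i ≤ d i) (M : QRep s t d)
    (hne : Nonempty (SubRep s t M e)) :
    ((((∑ i : V, e i * (d i - e i) : ℕ)) : ℕ∞) : WithBot ℕ∞) ≤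
      topologicalKrullDim (SubRep s t M e) +
        (((∑ a : A, e (s a) * (d (t a) - e (t a)) : ℕ) : ℕ∞) : WithBot ℕ∞) := by
  obtain ⟨N, hN, hNM⟩ := hne
  choose c hc using fun i => exists_splitting (N i) (hN i)
  have h0 : ∀ f ∈ chartEquations M c, MvPolynomial.eval 0 f = 0 := by
    refine (forall_mem_chartEquations_iff c).2 fun a => ?_
    have hframe (i : V) : (c i).frame (matOf (d := fun i => d i - e i) 0 i) = (c i).inl := by
      rw [Splitting.frame, show matOf (d := fun i => d i - e i) 0 i =
        (0 : Matrix (Fin (d i - e i)) (Fin (e i)) ℂ) from rfl,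
        Matrix.mul_zero, add_zero]
    rw [hframe, hframe, hc, hc]
    exact hNM a
  have hcard : Nat.card (Σ i : V, Fin (d i - e i) × Fin (e i)) = ∑ i : V, e i * (d i - e i) := by
    simp [mul_comm]
  have hencard : (chartEquations M c).encard ≤
      ((∑ a : A, e (s a) * (d (t a) - e (t a)) : ℕ) : ℕ∞) := by
    rw [chartEquations, ← Set.image_univ]
    refine (Set.encard_image_le _ _).trans (le_of_eq ?_)
    rw [Set.encard_univ, ENat.card_eq_coe_fintype_card]
    simp [mul_comm]
  calc _ = ((Nat.card (Σ i : V, Fin (d i - e i) × Fin (e i)) : ℕ∞) : WithBot ℕ∞) := by rw [hcard]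
    _ ≤ topologicalKrullDim (AffineZeros (chartEquations M c)) + (chartEquations M c).encard :=
      card_le_topologicalKrullDim_add _ h0
    _ ≤ _ := by
      gcongr
      · exact (isInducing_toSub_chartLift c).topologicalKrullDim_le
      · exact WithBot.coe_le_coe.2 hencard

end
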